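/- Let G be a subgroup of S_n with ℓ-local base T and let μ ∈ M_T. Then for all probability measures ν₁, ν₂ on G, W₁(ν₁,ν₂)² ≤ (c² K_n / 2) · ( √H(ν₁|μ) + √H(ν₂|μ) )², where c = min(2ℓ−1, n) and W₁ is the Wasserstein distance for the Hamming distance d_H. -/

import Mathlib

attribute [local instance] Classical.propDecidable

noncomputable section

/-- Hamming distance on permutations, as a real number. -/
noncomputable def dH {n : ℕ} (σ τ : Equiv.Perm (Fin n)) : ℝ :=
  ((Finset.univ.filter fun i => σ i ≠ τ i).card : ℝ)

/-- Degree (cardinality of the support) of a permutation. -/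
noncomputable def degree {n : ℕ} (σ : Equiv.Perm (Fin n)) : ℕ :=
  (Finset.univ.filter fun i => σ i ≠ i).card

/-- The subgroup `G_j` of elements of `G` fixing every index `> j`. -/
def Gj {n : ℕ} (G : Subgroup (Equiv.Perm (Fin n))) (j : Fin n) :
    Set (Equiv.Perm (Fin n)) :=
  {σ | σ ∈ G ∧ ∀ i : Fin n, j < i → σ i = i}

/-- The orbit `O_j` of `j` under `G_j`. -/
def Orb {n : ℕ} (G : Subgroup (Equiv.Perm (Fin n))) (j : Fin n) : Set (Fin n) :=
  {i | ∃ σ ∈ Gj G j, σ j = i}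

/-- An `ℓ`-local base of `G`. -/
def IsLocalBase {n : ℕ} (ℓ : ℕ) (G : Subgroup (Equiv.Perm (Fin n)))
    (t : Fin n → Fin n → Equiv.Perm (Fin n)) : Prop :=
  ∀ j : Fin n, (j : ℕ) ≠ 0 →
    t j j = 1 ∧ ∀ i ∈ Orb G j, i ≠ j →
      t i j ∈ Gj G j ∧ t i j i = j ∧ degree (t i j) ≤ ℓ

/-- The map `U_T (i_2, …, i_n) = t_{i_2,2} t_{i_3,3} ⋯ t_{i_n,n}`. -/
noncomputable def UT {n : ℕ} (t : Fin n → Fin n → Equiv.Perm (Fin n))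
    (i : Fin n → Fin n) : Equiv.Perm (Fin n) :=
  (((List.finRange n).drop 1).map fun j => t (i j) j).prod

/-- `μ` belongs to the class `M_T`: it is the pushforward under `U_T` of a product
of probability measures on the orbits `O_j`. -/
def MemMT {n : ℕ} (G : Subgroup (Equiv.Perm (Fin n)))
    (t : Fin n → Fin n → Equiv.Perm (Fin n)) (μ : Equiv.Perm (Fin n) → ℝ) : Prop :=
  ∃ νh : Fin n → Fin n → ℝ,
    (∀ j : Fin n,
      (∀ i, 0 ≤ νh j i) ∧ (∀ i, i ∉ Orb G j → νh j i = 0) ∧ ∑ i, νh j i = 1) ∧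
    ∀ σ, μ σ = ∑ i : Fin n → Fin n, if UT t i = σ then ∏ j, νh j (i j) else 0

/-- `K_n`, the number of indices `j ∈ {2, …, n}` with `O_j ≠ {j}`. -/
noncomputable def Kn {n : ℕ} (G : Subgroup (Equiv.Perm (Fin n))) : ℕ :=
  (Finset.univ.filter fun j : Fin n => (j : ℕ) ≠ 0 ∧ Orb G j ≠ {j}).card

/-- Relative entropy `H(ν | μ)` of finitely supported densities; `+∞` if `ν` is not
absolutely continuous with respect to `μ`. -/
noncomputable def relEnt {X : Type*} [Fintype X] (ν μ : X → ℝ) : ENNReal :=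
  if ∀ x, μ x = 0 → ν x = 0 then
    ENNReal.ofReal (∑ x, ν x * Real.log (ν x / μ x))
  else ⊤

/-- `p` is a probability measure supported on the set `S`. -/
def IsProbOn {X : Type*} [Fintype X] (p : X → ℝ) (S : Set X) : Prop :=
  (∀ x, 0 ≤ p x) ∧ (∀ x, x ∉ S → p x = 0) ∧ ∑ x, p x = 1

/-- The `W₁` Wasserstein distance for the cost `d`. -/
noncomputable def W1 {X : Type*} [Fintype X] (d : X → X → ℝ) (ν₁ ν₂ : X → ℝ) : ℝ :=
  sInf {w | ∃ π : X × X → ℝ,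
    (∀ q, 0 ≤ π q) ∧ (∀ x, ∑ y, π (x, y) = ν₁ x) ∧ (∀ y, ∑ x, π (x, y) = ν₂ y) ∧
    w = ∑ q : X × X, d q.1 q.2 * π q}

/-- Entropy of the density `f` with respect to the weight `P`. -/
def densityEnt {X : Type*} [Fintype X] (P f : X → ℝ) : ℝ :=
  ∑ x, P x * (f x * Real.log (f x))

/-- Transport-entropy inequality with constant `S` for couplings of two densities
with respect to the weight `P`, with cost `d`. -/
def TransportEntropy {X : Type*} [Fintype X] (P : X → ℝ) (d : X → X → ℝ) (S : ℝ) : Prop :=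
  ∀ f g : X → ℝ, (∀ x, 0 ≤ f x) → (∀ x, 0 ≤ g x) → ∑ x, P x * f x = 1 → ∑ x, P x * g x = 1 →
    ∃ π : X → X → ℝ, (∀ x y, 0 ≤ π x y) ∧ (∀ x, ∑ y, π x y = P x * f x) ∧
      (∀ y, ∑ x, π x y = P y * g y) ∧
      ∑ x, ∑ y, d x y * π x y ≤ √(S / 2) * (√(densityEnt P f) + √(densityEnt P g))

section Pinsker

lemma three_mul_sub_one_sq_le {x : ℝ} (hx : 0 ≤ x) :
    3 * (x - 1) ^ 2 ≤ (2 * x + 4) * InformationTheory.klFun x := by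
  rcases hx.eq_or_lt with rfl | hx
  · norm_num [InformationTheory.klFun]
  have hlog : ∀ y : ℝ, 1 ≤ y → 2 * (y - 1) ≤ (y + 1) * Real.log y := by
    intro y hy
    have h := Real.le_log_one_add_of_nonneg (x := y - 1) (by linarith)
    rw [show 1 + (y - 1) = y by ring, div_le_iff₀ (by linarith)] at h
    linarith
  have hlog' : ∀ y : ℝ, 0 < y → y ≤ 1 → (y + 1) * Real.log y ≤ 2 * (y - 1) := by
    intro y hy hy1
    have h := hlog y⁻¹ ((one_le_inv₀ hy).2 hy1)
    rw [Real.log_inv] at h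
    have h2 := mul_le_mul_of_nonneg_left h hy.le
    have h3 : y * y⁻¹ = 1 := mul_inv_cancel₀ hy.ne'
    nlinarith
  set h : ℝ → ℝ := fun y => (2 * y + 4) * InformationTheory.klFun y - 3 * (y - 1) ^ 2 with hh
  have hderiv : ∀ y : ℝ, 0 < y →
      HasDerivAt h (4 * ((y + 1) * Real.log y - 2 * (y - 1))) y := by
    intro y hy
    have h1 : HasDerivAt (fun y : ℝ => 2 * y + 4) 2 y := by
      simpa using ((hasDerivAt_id y).const_mul 2).add_const 4
    have h2 : HasDerivAt (fun y : ℝ => 3 * (y - 1) ^ 2) (3 * (2 * (y - 1))) y := by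
      simpa using (((hasDerivAt_id y).sub_const 1).pow 2).const_mul 3
    refine ((h1.mul (InformationTheory.hasDerivAt_klFun hy.ne')).sub h2).congr_deriv ?_
    rw [InformationTheory.klFun]
    ring
  have h1 : h 1 = 0 := by simp [hh, InformationTheory.klFun]
  suffices 0 ≤ h x by simp only [hh] at this; linarith
  rw [← h1]
  rcases le_total 1 x with hx1 | hx1
  · have hm : MonotoneOn h (Set.Ici 1) := by
      apply monotoneOn_of_deriv_nonneg (convex_Ici 1)
      · exact fun y hy => (hderiv y (lt_of_lt_of_le one_pos hy)).continuousAt.continuousWithinAt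
      · rw [interior_Ici]
        exact fun y hy =>
          (hderiv y (one_pos.trans hy)).differentiableAt.differentiableWithinAt
      · rw [interior_Ici]
        intro y hy
        rw [(hderiv y (one_pos.trans hy)).deriv]
        linarith [hlog y (le_of_lt hy)]
    exact hm (Set.mem_Ici.2 le_rfl) hx1 hx1
  · have hm : AntitoneOn h (Set.Ioc 0 1) := by
      apply antitoneOn_of_deriv_nonpos (convex_Ioc 0 1)
      · exact fun y hy => (hderiv y hy.1).continuousAt.continuousWithinAt
      · rw [interior_Ioc]
        exact fun y hy => (hderiv y hy.1).differentiableAt.differentiableWithinAt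
      · rw [interior_Ioc]
        intro y hy
        rw [(hderiv y hy.1).deriv]
        linarith [hlog' y hy.1 hy.2.le]
    exact hm ⟨hx, hx1⟩ ⟨one_pos, le_rfl⟩ hx1

variable {X : Type*} [Fintype X] {P f : X → ℝ}

lemma densityEnt_eq_sum_klFun (hP1 : ∑ x, P x = 1) (hf1 : ∑ x, P x * f x = 1) :
    densityEnt P f = ∑ x, P x * InformationTheory.klFun (f x) := by
  have : ∀ x, P x * InformationTheory.klFun (f x) =
      P x * (f x * Real.log (f x)) + P x - P x * f x := by
    intro x; rw [InformationTheory.klFun]; ring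
  simp only [this, Finset.sum_sub_distrib, Finset.sum_add_distrib, hP1, hf1, densityEnt]
  ring

lemma densityEnt_nonneg (hP : ∀ x, 0 ≤ P x) (hP1 : ∑ x, P x = 1) (hf : ∀ x, 0 ≤ f x)
    (hf1 : ∑ x, P x * f x = 1) : 0 ≤ densityEnt P f := by
  rw [densityEnt_eq_sum_klFun hP1 hf1]
  exact Finset.sum_nonneg fun x _ => mul_nonneg (hP x) (InformationTheory.klFun_nonneg (hf x))

/-- Pinsker's inequality. -/
lemma sum_abs_sub_one_le (hP : ∀ x, 0 ≤ P x) (hP1 : ∑ x, P x = 1) (hf : ∀ x, 0 ≤ f x)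
    (hf1 : ∑ x, P x * f x = 1) :
    ∑ x, P x * |f x - 1| ≤ 2 * (√(1 / 2) * √(densityEnt P f)) := by
  have key : (∑ x, P x * |f x - 1|) ^ 2 ≤
      (∑ x, P x * ((2 * f x + 4) / 3)) * ∑ x, P x * InformationTheory.klFun (f x) := by
    apply Finset.sum_sq_le_sum_mul_sum_of_sq_le_mul
    · exact fun x _ => mul_nonneg (hP x) (by linarith [hf x])
    · exact fun x _ => mul_nonneg (hP x) (InformationTheory.klFun_nonneg (hf x))
    · intro x _
      have h := mul_le_mul_of_nonneg_left (three_mul_sub_one_sq_le (hf x)) (sq_nonneg (P x))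
      rw [mul_pow, sq_abs]
      linarith
  have hs : ∑ x, P x * ((2 * f x + 4) / 3) = 2 := by
    have : ∀ x, P x * ((2 * f x + 4) / 3) = 2 / 3 * (P x * f x) + 4 / 3 * P x := by
      intro x; ring
    simp only [this, Finset.sum_add_distrib, ← Finset.mul_sum, hP1, hf1]
    norm_num
  rw [hs, ← densityEnt_eq_sum_klFun hP1 hf1] at key
  have hE := densityEnt_nonneg hP hP1 hf hf1
  refine abs_le_of_sq_le_sq' ?_ (by positivity) |>.2
  rw [mul_pow, mul_pow, Real.sq_sqrt (by norm_num), Real.sq_sqrt hE]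
  linarith

end Pinsker

section Coupling

variable {X : Type*} [Fintype X]

/-- Two probability vectors admit a coupling whose off-diagonal mass is at most their
total variation distance. -/
lemma exists_coupling_offDiag_le (a b : X → ℝ) (ha : ∀ x, 0 ≤ a x) (hb : ∀ x, 0 ≤ b x)
    (ha1 : ∑ x, a x = 1) (hb1 : ∑ x, b x = 1) :
    ∃ π : X → X → ℝ, (∀ x y, 0 ≤ π x y) ∧ (∀ x, ∑ y, π x y = a x) ∧
      (∀ y, ∑ x, π x y = b y) ∧
      ∑ x, ∑ y, (if x = y then 0 else π x y) ≤ (∑ x, |a x - b x|) / 2 := by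
  set m : X → ℝ := fun x => min (a x) (b x) with hm
  set δ : ℝ := 1 - ∑ x, m x with hδ
  have hma : ∀ x, 0 ≤ a x - m x := fun x => sub_nonneg.2 (min_le_left _ _)
  have hmb : ∀ x, 0 ≤ b x - m x := fun x => sub_nonneg.2 (min_le_right _ _)
  have hm0 : ∀ x, 0 ≤ m x := fun x => le_min (ha x) (hb x)
  have hsa : ∑ x, (a x - m x) = δ := by rw [Finset.sum_sub_distrib, ha1]
  have hsb : ∑ x, (b x - m x) = δ := by rw [Finset.sum_sub_distrib, hb1]
  have hδ0 : 0 ≤ δ := hsa ▸ Finset.sum_nonneg fun x _ => hma x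
  have hza : δ = 0 → ∀ x, a x - m x = 0 := fun h x =>
    (Finset.sum_eq_zero_iff_of_nonneg fun x _ => hma x).1 (hsa.trans h) x (Finset.mem_univ x)
  have hzb : δ = 0 → ∀ x, b x - m x = 0 := fun h x =>
    (Finset.sum_eq_zero_iff_of_nonneg fun x _ => hmb x).1 (hsb.trans h) x (Finset.mem_univ x)
  have hoff : ∀ x y, 0 ≤ (a x - m x) * (b y - m y) / δ := fun x y =>
    div_nonneg (mul_nonneg (hma x) (hmb y)) hδ0
  have hrow : ∀ x, ∑ y, (a x - m x) * (b y - m y) / δ = a x - m x := by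
    intro x
    rw [← Finset.sum_div, ← Finset.mul_sum, hsb]
    rcases eq_or_ne δ 0 with h | h
    · simp [hza h x]
    · field_simp
  have hcol : ∀ y, ∑ x, (a x - m x) * (b y - m y) / δ = b y - m y := by
    intro y
    rw [← Finset.sum_div, ← Finset.sum_mul, hsa]
    rcases eq_or_ne δ 0 with h | h
    · simp [hzb h y]
    · field_simp
  refine ⟨fun x y => (if x = y then m x else 0) + (a x - m x) * (b y - m y) / δ, ?_, ?_, ?_, ?_⟩
  · intro x y
    refine add_nonneg ?_ (hoff x y)
    split_ifs
    exacts [hm0 x, le_rfl]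
  · intro x
    simp [Finset.sum_add_distrib, hrow x]
  · intro y
    simp [Finset.sum_add_distrib, hcol y]
  · calc _ ≤ ∑ x, ∑ y, (a x - m x) * (b y - m y) / δ := by
          refine Finset.sum_le_sum fun x _ => Finset.sum_le_sum fun y _ => ?_
          split_ifs with h
          · exact hoff x y
          · simp only [if_neg h, zero_add, le_refl]
      _ = δ := by simp only [hrow, hsa]
      _ = _ := by
          have : ∀ x, |a x - b x| = (a x - m x) + (b x - m x) := by
            intro x
            rcases le_total (a x) (b x) with h | h
            · rw [abs_of_nonpos (by linarith), hm]
              simp only [min_eq_left h]; ring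
            · rw [abs_of_nonneg (by linarith), hm]
              simp only [min_eq_right h]; ring
          simp only [this, Finset.sum_add_distrib, hsa, hsb]
          ring

lemma transportEntropy_discrete (P : X → ℝ) (hP : ∀ x, 0 ≤ P x) (hP1 : ∑ x, P x = 1)
    {w : ℝ} (hw : 0 ≤ w) :
    TransportEntropy P (fun x y => if x = y then 0 else w) (w ^ 2) := by
  intro f g hf hg hf1 hg1
  obtain ⟨π, h0, hr, hc, hoff⟩ := exists_coupling_offDiag_le (fun x => P x * f x)
    (fun x => P x * g x) (fun x => mul_nonneg (hP x) (hf x)) (fun x => mul_nonneg (hP x) (hg x))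
    hf1 hg1
  refine ⟨π, h0, hr, hc, ?_⟩
  have h1 : ∑ x, ∑ y, (if x = y then 0 else w) * π x y =
      w * ∑ x, ∑ y, (if x = y then 0 else π x y) := by
    simp only [Finset.mul_sum]
    refine Finset.sum_congr rfl fun x _ => Finset.sum_congr rfl fun y _ => ?_
    split_ifs <;> simp
  have h2 : ∑ x, |P x * f x - P x * g x| ≤ ∑ x, P x * |f x - 1| + ∑ x, P x * |g x - 1| := by
    rw [← Finset.sum_add_distrib]
    refine Finset.sum_le_sum fun x _ => ?_
    rw [← mul_sub, abs_mul, abs_of_nonneg (hP x), ← mul_add]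
    refine mul_le_mul_of_nonneg_left ?_ (hP x)
    rw [abs_sub_comm (g x) 1]
    exact abs_sub_le _ _ _
  have h3 : √(w ^ 2 / 2) = w * √(1 / 2) := by
    rw [div_eq_mul_one_div, Real.sqrt_mul (sq_nonneg w), Real.sqrt_sq hw]
  rw [h1, h3, mul_assoc]
  refine mul_le_mul_of_nonneg_left ?_ hw
  linarith [sum_abs_sub_one_le hP hP1 hf hf1, sum_abs_sub_one_le hP hP1 hg hg1]

end Coupling

section Tensorization

lemma exists_conditional_density {Y : Type*} [Fintype Y] (Q h : Y → ℝ) (hQ : ∀ y, 0 ≤ Q y)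
    (hQ1 : ∑ y, Q y = 1) (hh : ∀ y, 0 ≤ h y) :
    ∃ k : Y → ℝ, (∀ y, 0 ≤ k y) ∧ ∑ y, Q y * k y = 1 ∧
      (∀ y, (∑ z, Q z * h z) * (Q y * k y) = Q y * h y) ∧
      densityEnt Q h = (∑ z, Q z * h z) * Real.log (∑ z, Q z * h z) +
        (∑ z, Q z * h z) * densityEnt Q k := by
  set M := ∑ z, Q z * h z with hM
  have hM0 : 0 ≤ M := Finset.sum_nonneg fun y _ => mul_nonneg (hQ y) (hh y)
  rcases eq_or_ne M 0 with h0 | h0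
  · have hz : ∀ y, Q y * h y = 0 := fun y =>
      (Finset.sum_eq_zero_iff_of_nonneg fun y _ => mul_nonneg (hQ y) (hh y)).1 (hM.symm.trans h0) y
        (Finset.mem_univ y)
    refine ⟨fun _ => 1, fun _ => zero_le_one, by simpa using hQ1, fun y => by simp [h0, hz y], ?_⟩
    simp [h0, densityEnt, ← mul_assoc, hz]
  · have hk1 : ∑ y, Q y * (h y / M) = 1 := by
      simp only [← mul_div_assoc, ← Finset.sum_div, ← hM]
      exact div_self h0
    refine ⟨fun y => h y / M, fun y => div_nonneg (hh y) hM0, hk1, fun y => by field_simp, ?_⟩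
    have hpt : ∀ y, Q y * (h y * Real.log (h y)) = M * Real.log M * (Q y * (h y / M)) +
        M * (Q y * (h y / M * Real.log (h y / M))) := by
      intro y
      rcases eq_or_ne (h y) 0 with hy | hy
      · simp [hy]
      · rw [Real.log_div hy h0]
        field_simp
        ring
    simp only [densityEnt, hpt, Finset.sum_add_distrib, ← Finset.mul_sum, hk1, mul_one]

lemma sum_mul_sqrt_le {X : Type*} [Fintype X] {w E : X → ℝ} (hw : ∀ x, 0 ≤ w x)
    (hw1 : ∑ x, w x = 1) (hE : ∀ x, 0 ≤ E x) : ∑ x, w x * √(E x) ≤ √(∑ x, w x * E x) := by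
  apply Real.le_sqrt_of_sq_le
  have h := Finset.sum_sq_le_sum_mul_sum_of_sq_le_mul Finset.univ (r := fun x => w x * √(E x))
    (f := w) (g := fun x => w x * E x) (fun x _ => hw x) (fun x _ => mul_nonneg (hw x) (hE x))
    (fun x _ => by rw [mul_pow, Real.sq_sqrt (hE x)]; exact le_of_eq (by ring))
  rwa [hw1, one_mul] at h

lemma sqrt_mul_sqrt_add_le {a b c d : ℝ} (ha : 0 ≤ a) (hb : 0 ≤ b) (hc : 0 ≤ c) (hd : 0 ≤ d) :
    √a * √c + √b * √d ≤ √(a + b) * √(c + d) := by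
  rw [← Real.sqrt_mul (add_nonneg ha hb)]
  apply Real.le_sqrt_of_sq_le
  nlinarith [Real.sq_sqrt ha, Real.sq_sqrt hb, Real.sq_sqrt hc, Real.sq_sqrt hd,
    sq_nonneg (√a * √d - √b * √c), mul_pow (√a) (√c) 2, mul_pow (√b) (√d) 2,
    mul_pow (√a) (√d) 2, mul_pow (√b) (√c) 2]

lemma TransportEntropy.prod {X Y : Type*} [Fintype X] [Fintype Y] {P : X → ℝ} {Q : Y → ℝ}
    {d : X → X → ℝ} {e : Y → Y → ℝ} {S T : ℝ} (hP : ∀ x, 0 ≤ P x) (hP1 : ∑ x, P x = 1)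
    (hQ : ∀ y, 0 ≤ Q y) (hQ1 : ∑ y, Q y = 1) (hS : 0 ≤ S) (hT : 0 ≤ T)
    (hX : TransportEntropy P d S) (hY : TransportEntropy Q e T) :
    TransportEntropy (fun q : X × Y => P q.1 * Q q.2)
      (fun q r => d q.1 r.1 + e q.2 r.2) (S + T) := by
  have chain : ∀ f : X × Y → ℝ, (∀ q, 0 ≤ f q) → ∑ q : X × Y, P q.1 * Q q.2 * f q = 1 →
      ∃ (f₁ : X → ℝ) (k : X → Y → ℝ), (∀ x, 0 ≤ f₁ x) ∧ (∀ x y, 0 ≤ k x y) ∧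
        ∑ x, P x * f₁ x = 1 ∧ (∀ x, ∑ y, Q y * k x y = 1) ∧
        (∀ x y, f₁ x * (Q y * k x y) = Q y * f (x, y)) ∧
        densityEnt (fun q : X × Y => P q.1 * Q q.2) f =
          densityEnt P f₁ + ∑ x, P x * f₁ x * densityEnt Q (k x) := by
    intro f hf hf1
    choose k hk0 hk1 hk hent using fun x =>
      exists_conditional_density Q (fun y => f (x, y)) hQ hQ1 fun y => hf (x, y)
    refine ⟨fun x => ∑ y, Q y * f (x, y), k,
      fun x => Finset.sum_nonneg fun y _ => mul_nonneg (hQ y) (hf _), hk0, ?_, hk1, hk, ?_⟩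
    · rw [← hf1, Fintype.sum_prod_type]
      simp only [Finset.mul_sum, mul_assoc]
    · rw [densityEnt, Fintype.sum_prod_type, densityEnt, ← Finset.sum_add_distrib]
      refine Finset.sum_congr rfl fun x _ => ?_
      have := hent x
      rw [densityEnt] at this
      simp only [mul_assoc, ← Finset.mul_sum, ← mul_add, this]
  intro f g hf hg hf1 hg1
  obtain ⟨f₁, k, hf₁, hk, hf₁1, hk1, hfk, hfent⟩ := chain f hf hf1
  obtain ⟨g₁, l, hg₁, hl, hg₁1, hl1, hgl, hgent⟩ := chain g hg hg1
  obtain ⟨κ, hκ, hκr, hκc, hκd⟩ := hX f₁ g₁ hf₁ hg₁ hf₁1 hg₁1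
  choose ρ hρ hρr hρc hρd using fun a b => hY (k a) (l b) (hk a) (hl b) (hk1 a) (hl1 b)
  have hρ1 : ∀ a b, ∑ y, ∑ z, ρ a b y z = 1 := fun a b => by simp only [hρr, hk1]
  have hEk : ∀ a, 0 ≤ densityEnt Q (k a) := fun a => densityEnt_nonneg hQ hQ1 (hk a) (hk1 a)
  have hEl : ∀ a, 0 ≤ densityEnt Q (l a) := fun a => densityEnt_nonneg hQ hQ1 (hl a) (hl1 a)
  refine ⟨fun q r => κ q.1 r.1 * ρ q.1 r.1 q.2 r.2, fun q r => mul_nonneg (hκ _ _) (hρ _ _ _ _),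
    ?_, ?_, ?_⟩
  · rintro ⟨a, y⟩
    rw [Fintype.sum_prod_type]
    simp only [← Finset.mul_sum, hρr, ← Finset.sum_mul, hκr]
    rw [mul_assoc, hfk, mul_assoc]
  · rintro ⟨b, z⟩
    rw [Fintype.sum_prod_type]
    simp only [← Finset.mul_sum, hρc, ← Finset.sum_mul, hκc]
    rw [mul_assoc, hgl, mul_assoc]
  · have hcost : ∑ q : X × Y, ∑ r : X × Y,
        (d q.1 r.1 + e q.2 r.2) * (κ q.1 r.1 * ρ q.1 r.1 q.2 r.2) =
        ∑ a, ∑ b, d a b * κ a b + ∑ a, ∑ b, κ a b * ∑ y, ∑ z, e y z * ρ a b y z := by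
      have hab : ∀ a b, d a b * κ a b + κ a b * ∑ y, ∑ z, e y z * ρ a b y z =
          ∑ y, ∑ z, (d a b + e y z) * (κ a b * ρ a b y z) := by
        intro a b
        rw [← mul_one (d a b * κ a b), ← hρ1 a b]
        simp only [Finset.mul_sum, ← Finset.sum_add_distrib]
        refine Finset.sum_congr rfl fun y _ => Finset.sum_congr rfl fun z _ => ?_
        ring
      simp only [← Finset.sum_add_distrib, hab, Fintype.sum_prod_type]
      refine Finset.sum_congr rfl fun a _ => ?_
      rw [Finset.sum_comm]
    have hcond : ∑ a, ∑ b, κ a b * ∑ y, ∑ z, e y z * ρ a b y z ≤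
        √(T / 2) * (∑ a, P a * f₁ a * √(densityEnt Q (k a)) +
          ∑ b, P b * g₁ b * √(densityEnt Q (l b))) := by
      calc _ ≤ ∑ a, ∑ b, κ a b *
            (√(T / 2) * (√(densityEnt Q (k a)) + √(densityEnt Q (l b)))) :=
            Finset.sum_le_sum fun a _ => Finset.sum_le_sum fun b _ =>
              mul_le_mul_of_nonneg_left (hρd a b) (hκ a b)
        _ = √(T / 2) * (∑ a, ∑ b, κ a b * √(densityEnt Q (k a)) +
              ∑ a, ∑ b, κ a b * √(densityEnt Q (l b))) := by
            simp only [Finset.mul_sum, ← Finset.sum_add_distrib]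
            refine Finset.sum_congr rfl fun a _ => Finset.sum_congr rfl fun b _ => ?_
            ring
        _ = _ := by
            rw [Finset.sum_comm (f := fun a b => κ a b * √(densityEnt Q (l b)))]
            simp only [← Finset.sum_mul, hκr, hκc]
    have hJf := sum_mul_sqrt_le (fun a => mul_nonneg (hP a) (hf₁ a)) hf₁1 hEk
    have hJg := sum_mul_sqrt_le (fun a => mul_nonneg (hP a) (hg₁ a)) hg₁1 hEl
    have hCf := sqrt_mul_sqrt_add_le (div_nonneg hS zero_le_two) (div_nonneg hT zero_le_two)
      (densityEnt_nonneg hP hP1 hf₁ hf₁1)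
      (Finset.sum_nonneg (s := Finset.univ) fun a _ =>
        mul_nonneg (mul_nonneg (hP a) (hf₁ a)) (hEk a))
    have hCg := sqrt_mul_sqrt_add_le (div_nonneg hS zero_le_two) (div_nonneg hT zero_le_two)
      (densityEnt_nonneg hP hP1 hg₁ hg₁1)
      (Finset.sum_nonneg (s := Finset.univ) fun a _ =>
        mul_nonneg (mul_nonneg (hP a) (hg₁ a)) (hEl a))
    rw [← hfent, ← add_div] at hCf
    rw [← hgent, ← add_div] at hCg
    have h2 := hcond.trans (mul_le_mul_of_nonneg_left (add_le_add hJf hJg) (Real.sqrt_nonneg _))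
    rw [hcost]
    linarith

lemma sum_fiber_mul {X Z : Type*} [Fintype X] [Fintype Z] (U : X → Z) (F : X → ℝ) (h : Z → ℝ) :
    ∑ z, (∑ x, if U x = z then F x else 0) * h z = ∑ x, F x * h (U x) := by
  simp only [Finset.sum_mul, ite_mul, zero_mul]
  rw [Finset.sum_comm]
  simp

/-- Transport-entropy inequalities pass to images under maps that do not increase the cost
on the support. -/
lemma TransportEntropy.map {X Z : Type*} [Fintype X] [Fintype Z] {P : X → ℝ} {P' : Z → ℝ}
    {d : X → X → ℝ} {d' : Z → Z → ℝ} {S : ℝ} (h : TransportEntropy P d S) (U : X → Z)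
    (hP' : ∀ z, P' z = ∑ x, if U x = z then P x else 0)
    (hd : ∀ x y, P x ≠ 0 → P y ≠ 0 → d' (U x) (U y) ≤ d x y) :
    TransportEntropy P' d' S := by
  have hsum : ∀ f : Z → ℝ, ∑ z, P' z * f z = ∑ x, P x * f (U x) := fun f => by
    simp only [hP', sum_fiber_mul]
  intro f g hf hg hf1 hg1
  obtain ⟨π, h0, hr, hc, hcost⟩ := h (fun x => f (U x)) (fun x => g (U x)) (fun x => hf _)
    (fun x => hg _) ((hsum f).symm.trans hf1) ((hsum g).symm.trans hg1)
  refine ⟨fun z z' => ∑ x, if U x = z then ∑ y, if U y = z' then π x y else 0 else 0,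
    ?_, ?_, ?_, ?_⟩
  · intro z z'
    refine Finset.sum_nonneg fun x _ => ?_
    split_ifs
    · refine Finset.sum_nonneg fun y _ => ?_
      split_ifs
      exacts [h0 x y, le_rfl]
    · exact le_rfl
  · intro z
    rw [Finset.sum_comm, hP', Finset.sum_mul]
    refine Finset.sum_congr rfl fun x _ => ?_
    split_ifs with hx
    · rw [Finset.sum_comm]
      simp [hr, hx]
    · simp
  · intro z'
    rw [Finset.sum_comm]
    simp only [Finset.sum_ite_eq, Finset.mem_univ, if_true]
    rw [Finset.sum_comm, hP', Finset.sum_mul]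
    refine Finset.sum_congr rfl fun y _ => ?_
    split_ifs with hy
    · simp [hc, hy]
    · simp
  · have hent : ∀ f : Z → ℝ, densityEnt P' f = densityEnt P fun x => f (U x) := fun f =>
      hsum fun z => f z * Real.log (f z)
    rw [hent f, hent g]
    refine le_trans ?_ hcost
    have : ∑ z, ∑ z', d' z z' * (∑ x, if U x = z then ∑ y, if U y = z' then π x y else 0 else 0)
        = ∑ x, ∑ y, d' (U x) (U y) * π x y := by
      simp only [Finset.mul_sum, mul_ite, mul_zero]
      rw [Finset.sum_congr rfl fun z _ => Finset.sum_comm, Finset.sum_comm]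
      refine Finset.sum_congr rfl fun x _ => ?_
      rw [Finset.sum_comm]
      simp only [Finset.sum_ite_eq, Finset.mem_univ, if_true]
      rw [Finset.sum_comm]
      simp
    rw [this]
    refine Finset.sum_le_sum fun x _ => Finset.sum_le_sum fun y _ => ?_
    rcases eq_or_ne (π x y) 0 with hπ | hπ
    · simp [hπ]
    refine mul_le_mul_of_nonneg_right (hd x y ?_ ?_) (h0 x y)
    · intro hx
      refine hπ ((Finset.sum_eq_zero_iff_of_nonneg fun y _ => h0 x y).1 ?_ y (Finset.mem_univ y))
      rw [hr, hx, zero_mul]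
    · intro hy
      refine hπ ((Finset.sum_eq_zero_iff_of_nonneg fun x _ => h0 x y).1 ?_ x (Finset.mem_univ x))
      rw [hc, hy, zero_mul]

/-- Marton's transport-entropy inequality for product measures and weighted Hamming costs. -/
lemma transportEntropy_pi {α : Type*} [Fintype α] {m : ℕ} (p : Fin m → α → ℝ) (w : Fin m → ℝ)
    (hp : ∀ j a, 0 ≤ p j a) (hp1 : ∀ j, ∑ a, p j a = 1) (hw : ∀ j, 0 ≤ w j) :
    TransportEntropy (fun x : Fin m → α => ∏ j, p j (x j))
      (fun x y => ∑ j, if x j = y j then 0 else w j) (∑ j, w j ^ 2) := by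
  induction m with
  | zero =>
    intro f g hf hg hf1 hg1
    simp only [Finset.univ_eq_empty, Finset.prod_empty, one_mul] at hf1 hg1 ⊢
    refine ⟨fun x y => f x * g y, fun x y => mul_nonneg (hf x) (hg y), fun x => ?_, fun y => ?_, ?_⟩
    · rw [← Finset.mul_sum, hg1, mul_one]
    · rw [← Finset.sum_mul, hf1, one_mul]
    · simp
  | succ m ih =>
    have hprod := (transportEntropy_discrete (p 0) (hp 0) (hp1 0) (hw 0)).prod (hp 0) (hp1 0)
      (fun y => Finset.prod_nonneg fun j _ => hp j.succ (y j))
      (by rw [← Fintype.prod_sum]; simp [hp1]) (sq_nonneg (w 0))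
      (Finset.sum_nonneg fun j _ => sq_nonneg (w (Fin.succ j)))
      (ih (fun j => p j.succ) (fun j => w j.succ) (fun j => hp j.succ) (fun j => hp1 j.succ)
        fun j => hw j.succ)
    rw [Fin.sum_univ_succ]
    refine hprod.map (Fin.consEquiv fun _ => α) (fun z => ?_) fun x y _ _ => ?_
    · rw [Fintype.sum_eq_single ((Fin.consEquiv fun _ => α).symm z), if_pos (Equiv.apply_symm_apply _ _)]
      · simp [Fin.prod_univ_succ, Fin.consEquiv, Fin.tail]
      · exact fun x hx => if_neg fun h => hx ((Equiv.eq_symm_apply _).2 h)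
    · simp [Fin.sum_univ_succ, Fin.consEquiv]

end Tensorization

section Permutations

variable {n : ℕ}

lemma dH_mul_mul_le (a b a' b' : Equiv.Perm (Fin n)) :
    dH (a * b) (a' * b') ≤ dH a a' + dH b b' := by
  unfold dH
  norm_cast
  have hsub : (Finset.univ.filter fun i => (a * b) i ≠ (a' * b') i) ⊆
      (Finset.univ.filter fun i => a i ≠ a' i).map b.symm.toEmbedding ∪
        Finset.univ.filter fun i => b i ≠ b' i := by
    intro i hi
    simp only [Finset.mem_filter, Finset.mem_univ, true_and, Finset.mem_union,
      Finset.mem_map] at hi ⊢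
    rw [Equiv.Perm.mul_apply, Equiv.Perm.mul_apply] at hi
    by_cases hb : b i = b' i
    · exact Or.inl ⟨b i, by rwa [← hb] at hi, by simp⟩
    · exact Or.inr hb
  refine (Finset.card_le_card hsub).trans ((Finset.card_union_le _ _).trans ?_)
  rw [Finset.card_map]

lemma dH_self (a : Equiv.Perm (Fin n)) : dH a a = 0 := by simp [dH]

lemma dH_nonneg (a b : Equiv.Perm (Fin n)) : 0 ≤ dH a b := Nat.cast_nonneg _

lemma dH_list_prod_le {ι : Type*} (a b : ι → Equiv.Perm (Fin n)) (L : List ι) :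
    dH (L.map a).prod (L.map b).prod ≤ (L.map fun j => dH (a j) (b j)).sum := by
  induction L with
  | nil => simp [dH_self]
  | cons j L ih =>
    simp only [List.map_cons, List.prod_cons, List.sum_cons]
    exact (dH_mul_mul_le _ _ _ _).trans (by gcongr)

lemma dH_UT_le (t : Fin n → Fin n → Equiv.Perm (Fin n)) (x y : Fin n → Fin n) :
    dH (UT t x) (UT t y) ≤
      ∑ j : Fin n, if (j : ℕ) = 0 then 0 else dH (t (x j) j) (t (y j) j) := by
  refine (dH_list_prod_le _ _ _).trans (le_of_eq ?_)
  cases n with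
  | zero => simp
  | succ n =>
    rw [List.finRange_succ, Fin.sum_univ_succ]
    simp [Function.comp_def, List.sum_ofFn, ← List.ofFn_eq_map]

lemma dH_le_of_degree_le {ℓ : ℕ} (hℓ : 1 ≤ ℓ) {s s' : Equiv.Perm (Fin n)} {j : Fin n}
    (hs : s = 1 ∨ s j ≠ j ∧ degree s ≤ ℓ) (hs' : s' = 1 ∨ s' j ≠ j ∧ degree s' ≤ ℓ) :
    dH s s' ≤ min (2 * (ℓ : ℝ) - 1) n := by
  have hn : dH s s' ≤ n := by
    rw [dH, Nat.cast_le]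
    exact (Finset.card_le_univ _).trans (Fintype.card_fin n).le
  refine le_min ?_ hn
  have hsub : (Finset.univ.filter fun i => s i ≠ s' i) ⊆
      (Finset.univ.filter fun i => s i ≠ i) ∪ Finset.univ.filter fun i => s' i ≠ i := by
    intro i hi
    simp only [Finset.mem_filter, Finset.mem_univ, true_and, Finset.mem_union] at hi ⊢
    by_contra! h
    exact hi (h.1.trans h.2.symm)
  have hcard := Finset.card_le_card hsub
  have hunion := Finset.card_union_add_card_inter (Finset.univ.filter fun i => s i ≠ i)
    (Finset.univ.filter fun i => s' i ≠ i)
  have hnat : (Finset.univ.filter fun i => s i ≠ s' i).card + 1 ≤ 2 * ℓ := by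
    rcases hs with rfl | ⟨hj, hd⟩
    · rcases hs' with rfl | ⟨hj', hd'⟩
      · simp; omega
      · simp [degree] at *; omega
    · rcases hs' with rfl | ⟨hj', hd'⟩
      · simp [degree] at *; omega
      · have hi : 0 < ((Finset.univ.filter fun i => s i ≠ i) ∩
            Finset.univ.filter fun i => s' i ≠ i).card :=
          Finset.card_pos.2 ⟨j, by simp [hj, hj']⟩
        rw [degree] at hd hd'
        omega
  have : ((Finset.univ.filter fun i => s i ≠ s' i).card : ℝ) + 1 ≤ 2 * ℓ := by exact_mod_cast hnat
  rw [dH]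
  linarith

lemma IsLocalBase.eq_one_or {ℓ : ℕ} {G : Subgroup (Equiv.Perm (Fin n))}
    {t : Fin n → Fin n → Equiv.Perm (Fin n)} (ht : IsLocalBase ℓ G t) {i j : Fin n}
    (hj : (j : ℕ) ≠ 0) (hi : i ∈ Orb G j) :
    t i j = 1 ∨ t i j j ≠ j ∧ degree (t i j) ≤ ℓ := by
  rcases eq_or_ne i j with rfl | hij
  · exact Or.inl (ht i hj).1
  · obtain ⟨-, h1, h2⟩ := (ht j hj).2 i hi hij
    exact Or.inr ⟨fun h => hij ((t i j).injective (h1.trans h.symm)), h2⟩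

lemma eq_one_of_Kn_eq_zero {G : Subgroup (Equiv.Perm (Fin n))} (hK : Kn G = 0)
    {σ : Equiv.Perm (Fin n)} (hσ : σ ∈ G) : σ = 1 := by
  by_contra hne
  have hex : (Finset.univ.filter fun i => σ i ≠ i).Nonempty := by
    by_contra h
    rw [Finset.not_nonempty_iff_eq_empty, Finset.filter_eq_empty_iff] at h
    exact hne (Equiv.ext fun i => not_not.1 (h (Finset.mem_univ i)))
  obtain ⟨j, hj, hmax⟩ := Finset.exists_max_image _ (fun i => i) hex
  simp only [Finset.mem_filter, Finset.mem_univ, true_and] at hj hmax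
  have hfix : ∀ i, j < i → σ i = i := fun i hi => by
    by_contra h
    exact absurd (hmax i h) (not_le.2 hi)
  by_cases hj0 : (j : ℕ) = 0
  · refine hj (σ.injective (hfix (σ j) (lt_of_le_of_ne ?_ (Ne.symm hj))))
    rw [Fin.le_def, hj0]
    exact Nat.zero_le _
  · rw [Kn, Finset.card_eq_zero, Finset.filter_eq_empty_iff] at hK
    have hO : Orb G j = {j} := by
      by_contra h
      exact hK (Finset.mem_univ j) ⟨hj0, h⟩
    have : σ j ∈ Orb G j := ⟨σ, ⟨hσ, hfix⟩, rfl⟩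
    rw [hO] at this
    exact hj this

/-- Measures in the class `M_T` satisfy a transport-entropy inequality. -/
lemma MemMT.transportEntropy {ℓ : ℕ} (hℓ : 1 ≤ ℓ) {G : Subgroup (Equiv.Perm (Fin n))}
    {t : Fin n → Fin n → Equiv.Perm (Fin n)} (ht : IsLocalBase ℓ G t)
    {μ : Equiv.Perm (Fin n) → ℝ} (hμ : MemMT G t μ) :
    TransportEntropy μ dH ((min (2 * (ℓ : ℝ) - 1) (n : ℝ)) ^ 2 * (Kn G : ℝ)) := by
  obtain ⟨p, hp, hμp⟩ := hμ
  set c : ℝ := min (2 * (ℓ : ℝ) - 1) n with hc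
  have hℓ' : (1 : ℝ) ≤ ℓ := by exact_mod_cast hℓ
  have hc0 : 0 ≤ c := le_min (by linarith) (Nat.cast_nonneg n)
  set w : Fin n → ℝ := fun j => if (j : ℕ) ≠ 0 ∧ Orb G j ≠ {j} then c else 0 with hw
  have hS : ∑ j, w j ^ 2 = c ^ 2 * (Kn G : ℝ) := by
    simp only [hw, ite_pow, zero_pow two_ne_zero, ← Finset.sum_filter, Finset.sum_const, Kn,
      nsmul_eq_mul]
    ring
  rw [← hS]
  refine (transportEntropy_pi p w (fun j => (hp j).1) (fun j => (hp j).2.2) fun j => ?_).map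
    (UT t) (fun σ => (hμp σ).trans (by congr!)) fun x y hx hy => (dH_UT_le t x y).trans (Finset.sum_le_sum fun j _ => ?_)
  · simp only [hw]
    split_ifs
    exacts [hc0, le_rfl]
  · have hmem : ∀ z : Fin n → Fin n, ∏ j, p j (z j) ≠ 0 → z j ∈ Orb G j := fun z hz => by
      by_contra h
      exact hz (Finset.prod_eq_zero (Finset.mem_univ j) ((hp j).2.1 _ h))
    have hxj := hmem x hx
    have hyj := hmem y hy
    by_cases hj : (j : ℕ) = 0
    · simp [hw, hj]
    rw [if_neg hj]
    split_ifs with hxy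
    · rw [hxy, dH_self]
    · have hO : Orb G j ≠ {j} := fun hO => by
        rw [hO] at hxj hyj
        exact hxy (hxj.trans hyj.symm)
      simp only [hw, if_pos (And.intro hj hO)]
      exact dH_le_of_degree_le hℓ (ht.eq_one_or hj hxj) (ht.eq_one_or hj hyj)

end Permutations

section Wasserstein

variable {X : Type*} [Fintype X] {d : X → X → ℝ} {ν₁ ν₂ : X → ℝ}

lemma W1_nonneg (hd : ∀ x y, 0 ≤ d x y) : 0 ≤ W1 d ν₁ ν₂ := by
  refine Real.sInf_nonneg ?_
  rintro w ⟨π, hπ, -, -, rfl⟩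
  exact Finset.sum_nonneg fun q _ => mul_nonneg (hd _ _) (hπ q)

lemma W1_le (hd : ∀ x y, 0 ≤ d x y) {π : X → X → ℝ} (hπ : ∀ x y, 0 ≤ π x y)
    (h₁ : ∀ x, ∑ y, π x y = ν₁ x) (h₂ : ∀ y, ∑ x, π x y = ν₂ y) :
    W1 d ν₁ ν₂ ≤ ∑ x, ∑ y, d x y * π x y := by
  refine csInf_le ⟨0, ?_⟩
    ⟨fun q => π q.1 q.2, fun q => hπ _ _, h₁, h₂, by rw [Fintype.sum_prod_type]⟩
  rintro w ⟨ρ, hρ, -, -, rfl⟩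
  exact Finset.sum_nonneg fun q _ => mul_nonneg (hd _ _) (hρ q)

lemma densityEnt_div {ν μ : X → ℝ} (h : ∀ x, μ x = 0 → ν x = 0) :
    densityEnt μ (fun x => ν x / μ x) = ∑ x, ν x * Real.log (ν x / μ x) := by
  refine Finset.sum_congr rfl fun x _ => ?_
  rw [← mul_assoc, mul_div_cancel_of_imp' (h x)]

/-- From couplings of densities to an inequality between `W1` and relative entropies. -/
lemma TransportEntropy.W1_sq_le {μ : X → ℝ} {S : ℝ} (h : TransportEntropy μ d S)
    (hd : ∀ x y, 0 ≤ d x y) (hμ : ∀ x, 0 ≤ μ x) (hS : 0 < S)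
    (h₁ : ∀ x, 0 ≤ ν₁ x) (h₂ : ∀ x, 0 ≤ ν₂ x) (hs₁ : ∑ x, ν₁ x = 1) (hs₂ : ∑ x, ν₂ x = 1) :
    ENNReal.ofReal (W1 d ν₁ ν₂ ^ 2) ≤ ENNReal.ofReal (S / 2) *
      (relEnt ν₁ μ ^ ((1 : ℝ) / 2) + relEnt ν₂ μ ^ ((1 : ℝ) / 2)) ^ 2 := by
  have hS2 : ENNReal.ofReal (S / 2) ≠ 0 := by simpa using hS
  by_cases hac₁ : ∀ x, μ x = 0 → ν₁ x = 0
  swap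
  · rw [relEnt, if_neg hac₁, ENNReal.top_rpow_of_pos (by norm_num), top_add,
      ENNReal.top_pow two_ne_zero, ENNReal.mul_top hS2]
    exact le_top
  by_cases hac₂ : ∀ x, μ x = 0 → ν₂ x = 0
  swap
  · rw [relEnt.eq_def ν₂, if_neg hac₂, ENNReal.top_rpow_of_pos (by norm_num), add_top,
      ENNReal.top_pow two_ne_zero, ENNReal.mul_top hS2]
    exact le_top
  have hm₁ : ∀ x, μ x * (ν₁ x / μ x) = ν₁ x := fun x => mul_div_cancel_of_imp' (hac₁ x)
  have hm₂ : ∀ x, μ x * (ν₂ x / μ x) = ν₂ x := fun x => mul_div_cancel_of_imp' (hac₂ x)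
  obtain ⟨π, hπ, hr, hc, hcost⟩ := h (fun x => ν₁ x / μ x) (fun x => ν₂ x / μ x)
    (fun x => div_nonneg (h₁ x) (hμ x)) (fun x => div_nonneg (h₂ x) (hμ x))
    (by simpa only [hm₁] using hs₁) (by simpa only [hm₂] using hs₂)
  rw [densityEnt_div hac₁, densityEnt_div hac₂] at hcost
  have hW := (W1_le hd hπ (fun x => (hr x).trans (hm₁ x)) fun y => (hc y).trans (hm₂ y)).trans hcost
  have hroot : ∀ E : ℝ, ENNReal.ofReal E ^ ((1 : ℝ) / 2) = ENNReal.ofReal √E := fun E => by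
    rcases le_total 0 E with hE | hE
    · rw [ENNReal.ofReal_rpow_of_nonneg hE (by norm_num), Real.sqrt_eq_rpow]
    · rw [ENNReal.ofReal_of_nonpos hE, Real.sqrt_eq_zero_of_nonpos hE]
      simp
  rw [relEnt, relEnt, if_pos hac₁, if_pos hac₂, hroot, hroot,
    ← ENNReal.ofReal_add (Real.sqrt_nonneg _) (Real.sqrt_nonneg _),
    ← ENNReal.ofReal_pow (by positivity), ← ENNReal.ofReal_mul (by positivity)]
  refine ENNReal.ofReal_le_ofReal ((pow_le_pow_left₀ (W1_nonneg hd) hW 2).trans (le_of_eq ?_))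
  rw [mul_pow, Real.sq_sqrt (by positivity)]

end Wasserstein

/-- Transport-entropy inequality for `W₁` and measures of the class `M_T`. -/
theorem stmt4 {n ℓ : ℕ} (hn : 2 ≤ n) (hℓ : 2 ≤ ℓ) (hℓn : ℓ ≤ n)
    (G : Subgroup (Equiv.Perm (Fin n))) (t : Fin n → Fin n → Equiv.Perm (Fin n))
    (ht : IsLocalBase ℓ G t) (μ : Equiv.Perm (Fin n) → ℝ) (hμ : MemMT G t μ)
    (ν₁ ν₂ : Equiv.Perm (Fin n) → ℝ)
    (hν₁ : IsProbOn ν₁ (G : Set (Equiv.Perm (Fin n))))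
    (hν₂ : IsProbOn ν₂ (G : Set (Equiv.Perm (Fin n)))) :
    ENNReal.ofReal (W1 dH ν₁ ν₂ ^ 2) ≤
      ENNReal.ofReal ((min (2 * (ℓ : ℝ) - 1) (n : ℝ)) ^ 2 * (Kn G : ℝ) / 2) *
        (relEnt ν₁ μ ^ ((1 : ℝ) / 2) + relEnt ν₂ μ ^ ((1 : ℝ) / 2)) ^ 2 := by
  rcases Nat.eq_zero_or_pos (Kn G) with hK | hK
  · have hW : W1 dH ν₁ ν₂ ≤ 0 := by
      refine (W1_le dH_nonneg (π := fun σ τ => ν₁ σ * ν₂ τ)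
        (fun σ τ => mul_nonneg (hν₁.1 σ) (hν₂.1 τ))
        (fun σ => by rw [← Finset.mul_sum, hν₂.2.2, mul_one])
        (fun τ => by rw [← Finset.sum_mul, hν₁.2.2, one_mul])).trans (le_of_eq ?_)
      refine Finset.sum_eq_zero fun σ _ => Finset.sum_eq_zero fun τ _ => ?_
      by_cases hσ : σ ∈ G
      · by_cases hτ : τ ∈ G
        · rw [eq_one_of_Kn_eq_zero hK hσ, eq_one_of_Kn_eq_zero hK hτ, dH_self, zero_mul]
        · rw [hν₂.2.1 τ hτ, mul_zero, mul_zero]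
      · rw [hν₁.2.1 σ hσ, zero_mul, mul_zero]
    rw [le_antisymm hW (W1_nonneg dH_nonneg)]
    simp
  · have hℓ' : (2 : ℝ) ≤ ℓ := by exact_mod_cast hℓ
    have hn' : (2 : ℝ) ≤ n := by exact_mod_cast hn
    have hc : 0 < min (2 * (ℓ : ℝ) - 1) (n : ℝ) := lt_min (by linarith) (by linarith)
    have hK' : (0 : ℝ) < Kn G := by exact_mod_cast hK
    refine (hμ.transportEntropy (by omega) ht).W1_sq_le dH_nonneg (fun σ => ?_) (by positivity)
      hν₁.1 hν₂.1 hν₁.2.2 hν₂.2.2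
    obtain ⟨p, hp, hμp⟩ := hμ
    rw [hμp]
    refine Finset.sum_nonneg fun x _ => ?_
    split_ifs
    · exact Finset.prod_nonneg fun j _ => (hp j).1 _
    · exact le_rfl

end
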